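/- Fix m ≥ 2 and let π_1 be the skew-symmetric (2m+1)×(2m+1) matrix-valued map on ℝ^{2m+1} with coordinates (a_1,…,a_{m+1}, b_1,…,b_m) determined by the brackets {a_1,b_1} = a_1, {a_j,b_j} = (1/2)a_j for j = 2,…,m, {a_{j+1},b_j} = −(1/2)a_{j+1} for j = 1,…,m−1, {a_{m+1},b_m} = −a_{m+1}, all other brackets zero. Then the function C(a,b) = a_1 · (Π_{j=2}^m a_j²) · a_{m+1} is a Casimir of π_1, i.e. π_1(a,b)·∇C(a,b) = 0 for all (a,b). -/

import Mathlib

/-- The `a`-coordinates (1-based `j`, `1 ≤ j ≤ m+1`) on `ℝ^{2m+1}` with coordinates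
`(a_1, …, a_{m+1}, b_1, …, b_m)`. -/
noncomputable def aV (m : ℕ) (x : Fin (2*m+1) → ℝ) (j : ℕ) : ℝ :=
  if h : 1 ≤ j ∧ j ≤ m + 1 then x ⟨j - 1, by omega⟩ else 0

/-- The `b`-coordinates (1-based `j`, `1 ≤ j ≤ m`) on `ℝ^{2m+1}`. -/
noncomputable def bV (m : ℕ) (x : Fin (2*m+1) → ℝ) (j : ℕ) : ℝ :=
  if h : 1 ≤ j ∧ j ≤ m then x ⟨m + j, by omega⟩ else 0

/-- The linear bracket `{a_i, b_j}` of `π₁`: `{a_1,b_1} = a_1`, `{a_j,b_j} = (1/2)a_j`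
(`2 ≤ j ≤ m`), `{a_{j+1},b_j} = -(1/2)a_{j+1}` (`1 ≤ j ≤ m-1`), `{a_{m+1},b_m} = -a_{m+1}`. -/
noncomputable def pi1ab (m : ℕ) (x : Fin (2*m+1) → ℝ) (i j : ℕ) : ℝ :=
  if i = 1 ∧ j = 1 then aV m x 1
  else if 2 ≤ i ∧ i ≤ m ∧ j = i then (1/2) * aV m x i
  else if i = j + 1 ∧ 1 ≤ j ∧ j ≤ m - 1 then -((1/2) * aV m x i)
  else if i = m + 1 ∧ j = m then -(aV m x (m+1))
  else 0

/-- The skew-symmetric Poisson matrix `π₁` on `ℝ^{2m+1}`; the first `m+1` (0-based)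
indices are the `a`-coordinates, the last `m` are the `b`-coordinates. -/
noncomputable def pi1M (m : ℕ) (x : Fin (2*m+1) → ℝ) :
    Matrix (Fin (2*m+1)) (Fin (2*m+1)) ℝ :=
  fun p q =>
    if (p : ℕ) ≤ m ∧ m < (q : ℕ) then pi1ab m x ((p : ℕ) + 1) ((q : ℕ) - m)
    else if (q : ℕ) ≤ m ∧ m < (p : ℕ) then -(pi1ab m x ((q : ℕ) + 1) ((p : ℕ) - m))
    else 0

lemma aV_hasFDerivAt (m : ℕ) (x v : Fin (2*m+1) → ℝ) (j : ℕ) :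
    ∃ L : (Fin (2*m+1) → ℝ) →L[ℝ] ℝ, HasFDerivAt (fun y => aV m y j) L x ∧ L v = aV m v j := by
  by_cases h : 1 ≤ j ∧ j ≤ m + 1
  · refine ⟨ContinuousLinearMap.proj ⟨j - 1, by omega⟩, ?_, ?_⟩
    · simp only [aV, dif_pos h]
      exact hasFDerivAt_apply _ _
    · simp [aV, dif_pos h]
  · refine ⟨0, ?_, ?_⟩
    · simp only [aV, dif_neg h]
      exact hasFDerivAt_const _ _
    · simp [aV, dif_neg h]

lemma prod_hasFDerivAt (m : ℕ) (x v : Fin (2*m+1) → ℝ) (w : ℕ → ℝ) (s : Finset ℕ)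
    (hw : ∀ j ∈ s, aV m v j = w j * aV m x j) :
    ∃ L : (Fin (2*m+1) → ℝ) →L[ℝ] ℝ,
      HasFDerivAt (fun y => ∏ j ∈ s, (aV m y j)^2) L x ∧
      L v = (∏ j ∈ s, (aV m x j)^2) * ∑ j ∈ s, 2 * w j := by
  induction s using Finset.induction_on with
  | empty => exact ⟨0, by simpa using hasFDerivAt_const _ _, by simp⟩
  | insert a s ha ih =>
    obtain ⟨L, hL, hLv⟩ := ih (fun j hj => hw j (Finset.mem_insert_of_mem hj))
    obtain ⟨K, hK, hKv⟩ := aV_hasFDerivAt m x v a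
    have hwa := hw a (Finset.mem_insert_self _ _)
    simp only [Finset.prod_insert ha, Finset.sum_insert ha]
    refine ⟨_, (hK.pow 2).mul hL, ?_⟩
    simp [hLv, hKv, hwa]
    ring

lemma C_fderiv (m : ℕ) (x v : Fin (2*m+1) → ℝ) (w : ℕ → ℝ)
    (hw : ∀ j, 1 ≤ j → j ≤ m + 1 → aV m v j = w j * aV m x j)
    (h0 : w 1 + ∑ j ∈ Finset.Icc 2 m, 2 * w j + w (m+1) = 0) :
    fderiv ℝ (fun y => aV m y 1 * (∏ j ∈ Finset.Icc 2 m, (aV m y j)^2) * aV m y (m+1)) x v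
      = 0 := by
  obtain ⟨L, hL, hLv⟩ := prod_hasFDerivAt m x v w (Finset.Icc 2 m) (fun j hj => by
    rw [Finset.mem_Icc] at hj
    exact hw j (by omega) (by omega))
  obtain ⟨K, hK, hKv⟩ := aV_hasFDerivAt m x v 1
  obtain ⟨J, hJ, hJv⟩ := aV_hasFDerivAt m x v (m+1)
  refine (DFunLike.congr_fun ((hK.mul hL).mul hJ).fderiv v).trans ?_
  simp only [Pi.mul_apply, add_apply, smul_apply, smul_eq_mul, hLv, hKv,
    hJv, hw 1 le_rfl (by omega), hw (m+1) (by omega) le_rfl]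
  linear_combination (aV m x 1 * (∏ j ∈ Finset.Icc 2 m, (aV m x j)^2) * aV m x (m+1)) * h0

theorem C_casimir_of_pi1 (m : ℕ) (hm : 2 ≤ m) (x : Fin (2*m+1) → ℝ) (p : Fin (2*m+1)) :
    ∑ q : Fin (2*m+1), pi1M m x p q *
      fderiv ℝ (fun y => aV m y 1 * (∏ j ∈ Finset.Icc 2 m, (aV m y j)^2) * aV m y (m+1))
        x (Pi.single q 1) = 0 := by
  have key : ∀ L : (Fin (2*m+1) → ℝ) →L[ℝ] ℝ,
      ∑ q : Fin (2*m+1), pi1M m x p q * L (Pi.single q 1) = L (pi1M m x p) := by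
    intro L
    conv_rhs => rw [pi_eq_sum_univ' (pi1M m x p)]
    rw [map_sum]
    refine Finset.sum_congr rfl fun q _ => ?_
    rw [map_smul, smul_eq_mul]
  rw [key]
  by_cases hp : (p : ℕ) ≤ m
  · apply C_fderiv m x _ (fun _ => 0)
    · intro j h1 h2
      have h3 : ¬ (m < j - 1) := by omega
      have h4 : ¬ (m < (p : ℕ)) := by omega
      simp [aV, h1, h2, pi1M, h3, h4]
    · simp
  · obtain ⟨k, hk⟩ : ∃ k, (p : ℕ) = m + k := ⟨p - m, by omega⟩
    have hk1 : 1 ≤ k := by omega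
    have hk2 : k ≤ m := by have := p.2; omega
    apply C_fderiv m x _ (fun i => (if i = k then (if k = 1 then -1 else -(1/2)) else 0) +
      (if i = k + 1 then (if k = m then 1 else 1/2) else 0))
    · intro j h1 h2
      have e : aV m (pi1M m x p) j = -(pi1ab m x j k) := by
        have h3 : j - 1 ≤ m := by omega
        have h4 : j - 1 + 1 = j := by omega
        simp [aV, h1, h2, pi1M, hp, hk, h3, h4, show 0 < k by omega, show k ≠ 0 by omega]
      rw [e]
      unfold pi1ab
      split_ifs <;> first | omega | skip
      all_goals first | (simp; done) | (simp_all; done) | (simp_all; ring)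
    · rw [← Finset.mul_sum, Finset.sum_add_distrib, Finset.sum_ite_eq', Finset.sum_ite_eq']
      simp only [Finset.mem_Icc]
      split_ifs <;> first | omega | norm_num
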